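/- Negative overrides raise surplus: let the experiment E' differ from E by a local mean preserving spread at s_j ∈ S, and let σ̂_E be the most selective equilibrium strategy of E. If σ̂_E(s_j) = 1 (so the spread is a negative override), then total surplus in the most selective equilibrium under E' weakly exceeds that under E: Π'(σ̂_{E'}) ≥ Π(σ̂_E). The analogous statement holds for the least selective equilibrium strategies: if σ̌_E(s_j) = 1 then Π'(σ̌_{E'}) ≥ Π(σ̌_E). -/

import Mathlib

open Finset Filter Topology

noncomputable section

/-- Probability that a single buyer rejects the seller, given conditional signal
distribution `p` and strategy `σ`: `r_θ(σ) = 1 - Σ_s p_θ(s)·σ(s)`. -/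
def rej {m : ℕ} (p σ : Fin m → ℝ) : ℝ := 1 - ∑ s, p s * σ s

/-- `ν_θ(σ) = (1/n)·Σ_{k=0}^{n-1} r_θ(σ)^k`: probability of being visited. -/
def visit (n : ℕ) {m : ℕ} (p σ : Fin m → ℝ) : ℝ :=
  (1 / (n : ℝ)) * ∑ k ∈ Finset.range n, rej p σ ^ k

/-- Interim belief `Ψ(σ) = ρ·ν_H(σ) / (ρ·ν_H(σ) + (1-ρ)·ν_L(σ))`. -/
def interim (ρ : ℝ) (n : ℕ) {m : ℕ} (pL pH σ : Fin m → ℝ) : ℝ :=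
  ρ * visit n pH σ / (ρ * visit n pH σ + (1 - ρ) * visit n pL σ)

/-- Posterior belief `Q_ψ(s) = ψ·p_H(s) / (ψ·p_H(s) + (1-ψ)·p_L(s))`. -/
def post {m : ℕ} (ψ : ℝ) (pL pH : Fin m → ℝ) (s : Fin m) : ℝ :=
  ψ * pH s / (ψ * pH s + (1 - ψ) * pL s)

/-- A strategy maps each signal to an acceptance probability in `[0,1]`. -/
def IsStrategy {m : ℕ} (σ : Fin m → ℝ) : Prop := ∀ s, 0 ≤ σ s ∧ σ s ≤ 1

/-- `σ` is an equilibrium strategy: with `ψ* = Ψ(σ)`, accept for sure when the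
posterior exceeds `c`, reject for sure when it falls below `c`. -/
def IsEquilibrium (ρ c : ℝ) (n : ℕ) {m : ℕ} (pL pH σ : Fin m → ℝ) : Prop :=
  IsStrategy σ ∧
  ∀ s : Fin m,
    (c < post (interim ρ n pL pH σ) pL pH s → σ s = 1) ∧
    (post (interim ρ n pL pH σ) pL pH s < c → σ s = 0)

/-- Total surplus `Π(σ) = (1-c)·ρ·(1-r_H(σ)^n) - c·(1-ρ)·(1-r_L(σ)^n)`. -/
def surplus (ρ c : ℝ) (n : ℕ) {m : ℕ} (pL pH σ : Fin m → ℝ) : ℝ :=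
  (1 - c) * ρ * (1 - rej pH σ ^ n) - c * (1 - ρ) * (1 - rej pL σ ^ n)

/-- The most selective equilibrium strategy. -/
def MostSelective (ρ c : ℝ) (n : ℕ) {m : ℕ} (pL pH σ : Fin m → ℝ) : Prop :=
  IsEquilibrium ρ c n pL pH σ ∧
  ∀ σ' : Fin m → ℝ, IsEquilibrium ρ c n pL pH σ' → ∀ s, σ s ≤ σ' s

/-- The least selective equilibrium strategy. -/
def LeastSelective (ρ c : ℝ) (n : ℕ) {m : ℕ} (pL pH σ : Fin m → ℝ) : Prop :=
  IsEquilibrium ρ c n pL pH σ ∧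
  ∀ σ' : Fin m → ℝ, IsEquilibrium ρ c n pL pH σ' → ∀ s, σ' s ≤ σ s

/-- An experiment: `p_L, p_H` are probability mass functions with full joint support,
indexed so that likelihood ratios are nondecreasing. -/
def IsExperiment {m : ℕ} (pL pH : Fin m → ℝ) : Prop :=
  (∀ s, 0 ≤ pL s) ∧ (∀ s, 0 ≤ pH s) ∧
  (∑ s, pL s = 1) ∧ (∑ s, pH s = 1) ∧
  (∀ s, 0 < pL s + pH s) ∧
  (∀ i j : Fin m, i ≤ j → pH i * pL j ≤ pH j * pL i)

/-- A strategy is monotone: a positive acceptance probability at `s_i` forces sure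
acceptance at every signal with strictly higher likelihood ratio. -/
def MonotoneStrategy {m : ℕ} (pL pH σ : Fin m → ℝ) : Prop :=
  ∀ i j : Fin m, 0 < σ i → pH i * pL j < pH j * pL i → σ j = 1


/-- Net gain from accepting a signal with conditional masses `x` (low state) and `y` (high state),
up to normalization, when the interim belief is induced by `σ`. -/
def gain (ρ c : ℝ) (n : ℕ) {m : ℕ} (pL pH σ : Fin m → ℝ) (x y : ℝ) : ℝ :=
  (1 - c) * ρ * visit n pH σ * y - c * (1 - ρ) * visit n pL σ * x

lemma rej_mem {m : ℕ} {p σ : Fin m → ℝ} (hp : ∀ s, 0 ≤ p s) (hsum : ∑ s, p s = 1)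
    (hσ : IsStrategy σ) : 0 ≤ rej p σ ∧ rej p σ ≤ 1 := by
  have h0 : 0 ≤ ∑ s, p s * σ s := Finset.sum_nonneg fun s _ => mul_nonneg (hp s) (hσ s).1
  have h1 : ∑ s, p s * σ s ≤ ∑ s, p s :=
    Finset.sum_le_sum fun s _ => mul_le_of_le_one_right (hp s) (hσ s).2
  unfold rej
  constructor <;> linarith

lemma geom_sum_pos_of_nonneg {n : ℕ} (hn : 1 ≤ n) {r : ℝ} (hr : 0 ≤ r) :
    0 < ∑ k ∈ Finset.range n, r ^ k :=
  Finset.sum_pos' (fun _ _ => pow_nonneg hr _) ⟨0, by simp; omega, by simp⟩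

lemma visit_pos {n : ℕ} (hn : 1 ≤ n) {m : ℕ} {p σ : Fin m → ℝ} (hp : ∀ s, 0 ≤ p s)
    (hsum : ∑ s, p s = 1) (hσ : IsStrategy σ) : 0 < visit n p σ := by
  have hn' : (0 : ℝ) < n := by exact_mod_cast hn
  exact mul_pos (by positivity) (geom_sum_pos_of_nonneg hn (rej_mem hp hsum hσ).1)

lemma post_interim {ρ : ℝ} {n m : ℕ} {pL pH σ : Fin m → ℝ}
    (hD : ρ * visit n pH σ + (1 - ρ) * visit n pL σ ≠ 0) (s : Fin m) :
    post (interim ρ n pL pH σ) pL pH s =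
      ρ * visit n pH σ * pH s / (ρ * visit n pH σ * pH s + (1 - ρ) * visit n pL σ * pL s) := by
  unfold post interim
  have h1 : 1 - ρ * visit n pH σ / (ρ * visit n pH σ + (1 - ρ) * visit n pL σ)
      = (1 - ρ) * visit n pL σ / (ρ * visit n pH σ + (1 - ρ) * visit n pL σ) := by
    field_simp
    ring
  rw [h1, div_mul_eq_mul_div, div_mul_eq_mul_div, ← add_div, div_div_div_cancel_right₀ hD]

lemma isEquilibrium_iff {ρ c : ℝ} (hρ : ρ ∈ Set.Ioo (0 : ℝ) 1) (hc : c ∈ Set.Ioo (0 : ℝ) 1)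
    {n : ℕ} (hn : 1 ≤ n) {m : ℕ} {pL pH σ : Fin m → ℝ}
    (hL : ∀ s, 0 ≤ pL s) (hH : ∀ s, 0 ≤ pH s) (hLs : ∑ s, pL s = 1) (hHs : ∑ s, pH s = 1) :
    IsEquilibrium ρ c n pL pH σ ↔ IsStrategy σ ∧ ∀ s,
      (0 < gain ρ c n pL pH σ (pL s) (pH s) → σ s = 1) ∧
      (gain ρ c n pL pH σ (pL s) (pH s) < 0 → σ s = 0) ∧
      (pL s = 0 → pH s = 0 → σ s = 0) := by
  obtain ⟨hρ0, hρ1⟩ := hρ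
  obtain ⟨hc0, hc1⟩ := hc
  refine and_congr_right fun hσ => forall_congr' fun s => ?_
  have hA : 0 < ρ * visit n pH σ := mul_pos hρ0 (visit_pos hn hH hHs hσ)
  have hB : 0 < (1 - ρ) * visit n pL σ := mul_pos (by linarith) (visit_pos hn hL hLs hσ)
  rw [post_interim (by positivity)]
  have hg : gain ρ c n pL pH σ (pL s) (pH s) = ρ * visit n pH σ * pH s
      - c * (ρ * visit n pH σ * pH s + (1 - ρ) * visit n pL σ * pL s) := by
    unfold gain; ring
  rw [hg]
  generalize ρ * visit n pH σ = A at *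
  generalize (1 - ρ) * visit n pL σ = B at *
  by_cases h0 : pL s = 0 ∧ pH s = 0
  · simp [h0.1, h0.2, hc0, hc0.le]
  · have hpos : 0 < A * pH s + B * pL s := by
      rcases (hL s).lt_or_eq with h | h
      · have := mul_pos hB h
        have := mul_nonneg hA.le (hH s)
        linarith
      · rcases (hH s).lt_or_eq with h' | h'
        · have := mul_pos hA h'
          have := mul_nonneg hB.le (hL s)
          linarith
        · exact absurd ⟨h.symm, h'.symm⟩ h0
    have hvac : (pL s = 0 → pH s = 0 → σ s = 0) ↔ True :=
      iff_true_intro fun h h' => absurd ⟨h, h'⟩ h0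
    rw [hvac, and_true, lt_div_iff₀ hpos, div_lt_iff₀ hpos, sub_pos, sub_neg]

lemma gain_pos_of_le {a b x y x' y' : ℝ} (ha : 0 < a) (hb : 0 < b) (hx : 0 ≤ x) (hy : 0 ≤ y)
    (hx' : 0 ≤ x') (hm' : 0 < x' + y') (hLR : y * x' ≤ y' * x)
    (h : 0 < a * y - b * x) : 0 < a * y' - b * x' := by
  by_contra! hneg
  have hyp : 0 < y := by
    by_contra! h0
    have : y = 0 := le_antisymm h0 hy
    subst this
    nlinarith [mul_nonneg hb.le hx]
  rcases hx'.lt_or_eq with h1 | h1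
  · nlinarith [mul_le_mul_of_nonneg_left hLR ha.le, mul_le_mul_of_nonneg_right hneg hx,
      mul_lt_mul_of_pos_right h h1]
  · subst h1
    nlinarith [mul_pos ha (show 0 < y' by linarith)]

lemma gain_nonneg_of_le {a b x y x' y' : ℝ} (ha : 0 < a) (hb : 0 < b) (hy : 0 ≤ y)
    (hx' : 0 ≤ x') (hy' : 0 ≤ y') (hm : 0 < x + y) (hLR : y * x' ≤ y' * x)
    (h : 0 ≤ a * y - b * x) : 0 ≤ a * y' - b * x' := by
  by_contra! hneg
  have := gain_pos_of_le (y' := x) hb ha hy' hx' hy (by linarith) (by linarith)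
    (show 0 < b * x' - a * y' by linarith)
  linarith

/-- In equilibrium the high type is rejected less often than the low type. -/
lemma rej_high_le_rej_low {m : ℕ} {pL pH σ : Fin m → ℝ} {a b : ℝ} (ha : 0 < a)
    (hL : ∀ s, 0 ≤ pL s) (hLs : ∑ s, pL s = 1) (hHs : ∑ s, pH s = 1)
    (hσ : IsStrategy σ)
    (h : ∀ s, (0 < a * pH s - b * pL s → σ s = 1) ∧ (a * pH s - b * pL s < 0 → σ s = 0)) :
    rej pH σ ≤ rej pL σ := by
  unfold rej
  rcases le_total a b with hab | hab
  · suffices ∑ s, pL s * σ s ≤ ∑ s, pH s * σ s by linarith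
    refine Finset.sum_le_sum fun s _ => ?_
    rcases (hσ s).1.lt_or_eq with h0 | h0
    · refine mul_le_mul_of_nonneg_right ?_ h0.le
      have : 0 ≤ a * pH s - b * pL s := by
        by_contra! hlt
        exact h0.ne' ((h s).2 hlt)
      nlinarith [hL s]
    · simp [← h0]
  · have key : ∑ s, pH s * (1 - σ s) ≤ ∑ s, pL s * (1 - σ s) := by
      refine Finset.sum_le_sum fun s _ => ?_
      rcases (hσ s).2.lt_or_eq with h1 | h1
      · refine mul_le_mul_of_nonneg_right ?_ (by linarith)
        have : a * pH s - b * pL s ≤ 0 := by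
          by_contra! hlt
          exact h1.ne ((h s).1 hlt)
        nlinarith [hL s]
      · simp [h1]
    simp only [mul_sub, mul_one, Finset.sum_sub_distrib, hLs, hHs] at key
    linarith

lemma geom_sum₂_mul_geom_sum_le {n : ℕ} {x y r : ℝ} (hx : 0 ≤ x) (hxy : x ≤ y) (hr0 : 0 ≤ r)
    (hr1 : r ≤ 1) :
    (∑ k ∈ Finset.range n, x ^ k * r ^ (n - 1 - k)) * ∑ k ∈ Finset.range n, y ^ k ≤
      (∑ k ∈ Finset.range n, y ^ k * r ^ (n - 1 - k)) * ∑ k ∈ Finset.range n, x ^ k := by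
  have hpow : ∀ k l : ℕ, k ≤ l → x ^ l * y ^ k ≤ y ^ l * x ^ k := by
    intro k l hkl
    obtain ⟨d, rfl⟩ := Nat.exists_eq_add_of_le hkl
    have h1 := mul_le_mul_of_nonneg_left (pow_le_pow_left₀ hx hxy d)
      (mul_nonneg (pow_nonneg hx k) (pow_nonneg (hx.trans hxy) k))
    rw [pow_add, pow_add]
    linarith
  have hterm : ∀ k l : ℕ, k ≤ l →
      (r ^ (n - 1 - k) - r ^ (n - 1 - l)) * (x ^ k * y ^ l - y ^ k * x ^ l) ≤ 0 := by
    intro k l hkl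
    refine mul_nonpos_of_nonpos_of_nonneg ?_ ?_
    · linarith [pow_le_pow_of_le_one hr0 hr1 (show n - 1 - l ≤ n - 1 - k by omega)]
    · linarith [hpow k l hkl]
  have hsym : ∑ k ∈ Finset.range n, ∑ l ∈ Finset.range n,
      (r ^ (n - 1 - k) - r ^ (n - 1 - l)) * (x ^ k * y ^ l - y ^ k * x ^ l) ≤ 0 := by
    refine Finset.sum_nonpos fun k _ => Finset.sum_nonpos fun l _ => ?_
    rcases le_total k l with h | h
    · exact hterm k l h
    · linarith [hterm l k h]
  have hsplit : ∑ k ∈ Finset.range n, ∑ l ∈ Finset.range n,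
      (r ^ (n - 1 - k) - r ^ (n - 1 - l)) * (x ^ k * y ^ l - y ^ k * x ^ l) =
      2 * ((∑ k ∈ Finset.range n, x ^ k * r ^ (n - 1 - k)) * ∑ k ∈ Finset.range n, y ^ k -
      (∑ k ∈ Finset.range n, y ^ k * r ^ (n - 1 - k)) * ∑ k ∈ Finset.range n, x ^ k) := by
    have e1 : ∀ u v : ℝ, (∑ k ∈ Finset.range n, u ^ k * r ^ (n - 1 - k)) *
        ∑ k ∈ Finset.range n, v ^ k = ∑ k ∈ Finset.range n, ∑ l ∈ Finset.range n,
          r ^ (n - 1 - k) * (u ^ k * v ^ l) := by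
      intro u v
      rw [Finset.sum_mul_sum]
      exact Finset.sum_congr rfl fun k _ => Finset.sum_congr rfl fun l _ => by ring
    have e2 : ∀ u v : ℝ, (∑ k ∈ Finset.range n, u ^ k * r ^ (n - 1 - k)) *
        ∑ k ∈ Finset.range n, v ^ k = ∑ k ∈ Finset.range n, ∑ l ∈ Finset.range n,
          r ^ (n - 1 - l) * (v ^ k * u ^ l) := by
      intro u v
      rw [e1, Finset.sum_comm]
      exact Finset.sum_congr rfl fun k _ => Finset.sum_congr rfl fun l _ => by ring
    rw [two_mul]
    nth_rewrite 1 [e1 x y, e1 y x]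
    rw [e2 x y, e2 y x]
    simp only [← Finset.sum_sub_distrib, ← Finset.sum_add_distrib]
    exact Finset.sum_congr rfl fun k _ => Finset.sum_congr rfl fun l _ => by ring
  linarith

/-- Raising both rejection probabilities raises surplus if it is profitable at the interim belief
induced by the higher ones. -/
lemma mul_pow_sub_pow_le {n : ℕ} (hn : 1 ≤ n) {a b u v x y : ℝ} (hb : 0 ≤ b)
    (hu : 0 ≤ u) (huv : u ≤ v) (hv : v ≤ 1) (hux : u ≤ x) (hvy : v ≤ y) (hxy : x ≤ y)
    (h : a * (∑ k ∈ Finset.range n, x ^ k) * (x - u) ≤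
      b * (∑ k ∈ Finset.range n, y ^ k) * (y - v)) :
    a * (x ^ n - u ^ n) ≤ b * (y ^ n - v ^ n) := by
  have hx0 := hu.trans hux
  have hW : (∑ k ∈ Finset.range n, x ^ k * u ^ (n - 1 - k)) * ∑ k ∈ Finset.range n, y ^ k ≤
      (∑ k ∈ Finset.range n, y ^ k * v ^ (n - 1 - k)) * ∑ k ∈ Finset.range n, x ^ k := by
    refine le_trans ?_ (geom_sum₂_mul_geom_sum_le hx0 hxy (hu.trans huv) hv)
    refine mul_le_mul_of_nonneg_right ?_ (geom_sum_pos_of_nonneg hn (hx0.trans hxy)).le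
    exact Finset.sum_le_sum fun k _ =>
      mul_le_mul_of_nonneg_left (pow_le_pow_left₀ hu huv _) (pow_nonneg hx0 _)
  have hW0 : 0 ≤ ∑ k ∈ Finset.range n, x ^ k * u ^ (n - 1 - k) :=
    Finset.sum_nonneg fun k _ => by positivity
  have hV := geom_sum_pos_of_nonneg hn hx0
  rw [← geom_sum₂_mul x u n, ← geom_sum₂_mul y v n]
  refine le_of_mul_le_mul_right ?_ hV
  have h1 := mul_le_mul_of_nonneg_left h hW0
  have h2 := mul_le_mul_of_nonneg_left hW (mul_nonneg hb (sub_nonneg.2 hvy))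
  linarith

lemma rej_sub_rej {m : ℕ} (p σ τ : Fin m → ℝ) :
    rej p τ - rej p σ = ∑ s, p s * (σ s - τ s) := by
  simp only [rej, mul_sub, Finset.sum_sub_distrib]
  ring

/-- An equilibrium yields more surplus than any less selective strategy that favours the
high type. -/
lemma surplus_le_of_isEquilibrium {ρ c : ℝ} (hρ : ρ ∈ Set.Ioo (0 : ℝ) 1)
    (hc : c ∈ Set.Ioo (0 : ℝ) 1) {n : ℕ} (hn : 1 ≤ n) {m : ℕ} {pL pH σ τ : Fin m → ℝ}
    (hL : ∀ s, 0 ≤ pL s) (hH : ∀ s, 0 ≤ pH s) (hLs : ∑ s, pL s = 1) (hHs : ∑ s, pH s = 1)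
    (hτ : IsEquilibrium ρ c n pL pH τ) (hσ : IsStrategy σ) (hle : ∀ s, τ s ≤ σ s)
    (hσr : rej pH σ ≤ rej pL σ) : surplus ρ c n pL pH σ ≤ surplus ρ c n pL pH τ := by
  rw [isEquilibrium_iff hρ hc hn hL hH hLs hHs] at hτ
  obtain ⟨hτs, hτe⟩ := hτ
  obtain ⟨hρ0, hρ1⟩ := hρ
  obtain ⟨hc0, hc1⟩ := hc
  have hn' : (0 : ℝ) < n := by exact_mod_cast hn
  have ha : 0 < (1 - c) * ρ := mul_pos (by linarith) hρ0
  have hb : 0 < c * (1 - ρ) := mul_pos hc0 (by linarith)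
  have hτr : rej pH τ ≤ rej pL τ :=
    rej_high_le_rej_low (mul_pos ha (visit_pos hn hH hHs hτs)) hL hLs hHs hτs
      fun s => ⟨(hτe s).1, (hτe s).2.1⟩
  have hd : ∀ p : Fin m → ℝ, (∀ s, 0 ≤ p s) → rej p σ ≤ rej p τ := fun p hp => by
    have : 0 ≤ rej p τ - rej p σ := by
      rw [rej_sub_rej]
      exact Finset.sum_nonneg fun s _ => mul_nonneg (hp s) (sub_nonneg.2 (hle s))
    linarith
  have hsum : (1 - c) * ρ * visit n pH τ * (rej pH τ - rej pH σ) ≤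
      c * (1 - ρ) * visit n pL τ * (rej pL τ - rej pL σ) := by
    rw [rej_sub_rej, rej_sub_rej, Finset.mul_sum, Finset.mul_sum]
    refine Finset.sum_le_sum fun s _ => ?_
    rcases (hτs s).2.lt_or_eq with h1 | h1
    · have hg : gain ρ c n pL pH τ (pL s) (pH s) ≤ 0 := by
        by_contra! hlt
        exact h1.ne ((hτe s).1 hlt)
      unfold gain at hg
      nlinarith [mul_le_mul_of_nonneg_right hg (sub_nonneg.2 (hle s))]
    · have : σ s = τ s := le_antisymm (by rw [h1]; exact (hσ s).2) (hle s)
      simp [this]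
  have key := mul_pow_sub_pow_le hn hb.le (rej_mem hH hHs hσ).1 hσr
    (rej_mem hL hLs hσ).2 (hd pH hH) (hd pL hL) hτr (by
      have h2 := mul_le_mul_of_nonneg_left hsum hn'.le
      unfold visit at h2
      have e : ∀ t V d : ℝ, (n : ℝ) * (t * (1 / (n : ℝ) * V) * d) = t * V * d := by
        intro t V d
        field_simp
      rwa [e, e] at h2)
  unfold surplus
  linarith

/-- Acceptance mass can be moved between two signals at which buyers are indifferent. -/
lemma exists_isEquilibrium_lt {ρ c : ℝ} (hρ : ρ ∈ Set.Ioo (0 : ℝ) 1)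
    (hc : c ∈ Set.Ioo (0 : ℝ) 1) {n : ℕ} (hn : 1 ≤ n) {m : ℕ} {pL pH σ : Fin m → ℝ}
    (hL : ∀ s, 0 ≤ pL s) (hH : ∀ s, 0 ≤ pH s) (hLs : ∑ s, pL s = 1) (hHs : ∑ s, pH s = 1)
    (hσ : IsEquilibrium ρ c n pL pH σ) {s t : Fin m} (hst : s ≠ t)
    (hms : 0 < pL s + pH s) (hmt : 0 < pL t + pH t)
    (hgs : gain ρ c n pL pH σ (pL s) (pH s) = 0) (hgt : gain ρ c n pL pH σ (pL t) (pH t) = 0)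
    (hs : 0 < σ s) (ht : σ t < 1) : ∃ τ, IsEquilibrium ρ c n pL pH τ ∧ σ t < τ t := by
  have hσ' := hσ
  rw [isEquilibrium_iff hρ hc hn hL hH hLs hHs] at hσ
  obtain ⟨hσs, hσe⟩ := hσ
  have ha : 0 < (1 - c) * ρ * visit n pH σ :=
    mul_pos (mul_pos (by linarith [hc.2]) hρ.1) (visit_pos hn hH hHs hσs)
  have hb : 0 < c * (1 - ρ) * visit n pL σ :=
    mul_pos (mul_pos hc.1 (by linarith [hρ.2])) (visit_pos hn hL hLs hσs)
  unfold gain at hgs hgt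
  set a := (1 - c) * ρ * visit n pH σ with hadef
  set b := c * (1 - ρ) * visit n pL σ with hbdef
  have hLpos : ∀ r, 0 < pL r + pH r → a * pH r - b * pL r = 0 → 0 < pL r := by
    intro r hm hg
    rcases (hL r).lt_or_eq with h | h
    · exact h
    · rw [← h] at hm hg
      nlinarith
  have hps := hLpos s hms hgs
  have hpt := hLpos t hmt hgt
  set ε := min (σ s * pL s) ((1 - σ t) * pL t) with hε
  have hε0 : 0 < ε := lt_min (mul_pos hs hps) (mul_pos (by linarith) hpt)
  have hεs : ε / pL s ≤ σ s := by
    rw [div_le_iff₀ hps]; exact min_le_left _ _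
  have hεt : ε / pL t ≤ 1 - σ t := by
    rw [div_le_iff₀ hpt]; exact min_le_right _ _
  have hεs0 : 0 < ε / pL s := div_pos hε0 hps
  have hεt0 : 0 < ε / pL t := div_pos hε0 hpt
  set τ : Fin m → ℝ := fun r =>
    σ r + (if r = s then -(ε / pL s) else 0) + (if r = t then ε / pL t else 0) with hτ
  have hsum : ∀ p : Fin m → ℝ, p s * (ε / pL s) = p t * (ε / pL t) → rej p τ = rej p σ := by
    intro p hp
    simp only [rej, hτ, mul_add, mul_ite, mul_zero, Finset.sum_add_distrib,
      Finset.sum_ite_eq', Finset.mem_univ, if_true]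
    linarith
  have hrL : rej pL τ = rej pL σ := hsum pL (by field_simp)
  have hrH : rej pH τ = rej pH σ := hsum pH (by
    have e : ∀ r, 0 < pL r → a * pH r - b * pL r = 0 → pH r = b / a * pL r := by
      intro r _ hg
      field_simp
      linarith
    rw [e s hps hgs, e t hpt hgt]
    field_simp)
  have hvL : visit n pL τ = visit n pL σ := by simp [visit, hrL]
  have hvH : visit n pH τ = visit n pH σ := by simp [visit, hrH]
  refine ⟨τ, ?_, by simp [hτ, hst.symm, hεt0]⟩
  rw [isEquilibrium_iff hρ hc hn hL hH hLs hHs]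
  unfold gain at hσe ⊢
  rw [hvL, hvH, ← hadef, ← hbdef]
  refine ⟨fun r => ?_, fun r => ?_⟩
  · have h := hσs r
    by_cases h1 : r = s
    · subst h1
      simp only [hτ, if_true, if_neg hst]
      constructor <;> linarith
    · by_cases h2 : r = t
      · subst h2
        simp only [hτ, if_true, if_neg h1]
        constructor <;> linarith
      · simpa [hτ, h1, h2] using h
  · by_cases h1 : r = s
    · subst h1
      exact ⟨fun h => absurd hgs h.ne', fun h => absurd hgs h.ne, fun h => absurd h hps.ne'⟩
    · by_cases h2 : r = t
      · subst h2
        exact ⟨fun h => absurd hgt h.ne', fun h => absurd hgt h.ne, fun h => absurd h hpt.ne'⟩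
      · simpa [hτ, h1, h2] using hσe r

/-- Reject below `k`, accept with probability `w` at `k`, accept above `k`. -/
def stepStrategy {m : ℕ} (k : ℕ) (w : ℝ) (s : Fin m) : ℝ :=
  if s.val < k then 0 else if s.val = k then w else 1

lemma stepStrategy_succ {m : ℕ} (k : ℕ) :
    (stepStrategy k 0 : Fin m → ℝ) = stepStrategy (k + 1) 1 := by
  ext s
  unfold stepStrategy
  split_ifs <;> first | rfl | omega

lemma isStrategy_stepStrategy {m : ℕ} (k : ℕ) {w : ℝ} (hw : w ∈ Set.Icc (0 : ℝ) 1) :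
    IsStrategy (stepStrategy k w : Fin m → ℝ) := by
  intro s
  unfold stepStrategy
  split_ifs
  · simp
  · exact hw
  · simp

lemma continuous_gain_stepStrategy (ρ c : ℝ) (n : ℕ) {m : ℕ} (pL pH : Fin m → ℝ) (k : ℕ)
    (x y : ℝ) : Continuous fun w => gain ρ c n pL pH (stepStrategy k w) x y := by
  have h : ∀ s : Fin m, Continuous fun w => stepStrategy k w s := by
    intro s
    unfold stepStrategy
    split_ifs <;> fun_prop
  unfold gain visit rej
  fun_prop

/-- If rejecting at `k` and below is optimal given the cutoff strategy accepting from `k` on, some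
strategy that is optimal at the belief it induces rejects everything below `k`. Optimality is tested
at sorted signal masses `mL`, `mH`, which may differ from the experiment. -/
lemma exists_optimal_below {ρ c : ℝ} (hρ : ρ ∈ Set.Ioo (0 : ℝ) 1)
    (hc : c ∈ Set.Ioo (0 : ℝ) 1) {n : ℕ} (hn : 1 ≤ n) {m : ℕ} {pL pH mL mH : Fin m → ℝ}
    (hL : ∀ s, 0 ≤ pL s) (hH : ∀ s, 0 ≤ pH s) (hLs : ∑ s, pL s = 1) (hHs : ∑ s, pH s = 1)
    (hmL : ∀ s, 0 ≤ mL s) (hmH : ∀ s, 0 ≤ mH s) (hm : ∀ s, 0 < mL s + mH s)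
    (hLR : ∀ s t, s ≤ t → mH s * mL t ≤ mH t * mL s) (k : ℕ)
    (hk : ∀ s : Fin m, s.val ≤ k →
      gain ρ c n pL pH (stepStrategy k 1) (mL s) (mH s) ≤ 0) :
    ∃ σ : Fin m → ℝ, IsStrategy σ ∧ (∀ s, s.val < k → σ s = 0) ∧
      ∀ s, (0 < gain ρ c n pL pH σ (mL s) (mH s) → σ s = 1) ∧
        (gain ρ c n pL pH σ (mL s) (mH s) < 0 → σ s = 0) := by
  have hab : ∀ {σ : Fin m → ℝ}, IsStrategy σ → 0 < (1 - c) * ρ * visit n pH σ ∧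
      0 < c * (1 - ρ) * visit n pL σ := fun hσ =>
    ⟨mul_pos (mul_pos (by linarith [hc.2]) hρ.1) (visit_pos hn hH hHs hσ),
      mul_pos (mul_pos hc.1 (by linarith [hρ.2])) (visit_pos hn hL hLs hσ)⟩
  have hmono : ∀ {σ : Fin m → ℝ}, IsStrategy σ → ∀ {s t : Fin m}, s ≤ t →
      0 ≤ gain ρ c n pL pH σ (mL s) (mH s) → 0 ≤ gain ρ c n pL pH σ (mL t) (mH t) :=
    fun hσ _ _ hst h => gain_nonneg_of_le (hab hσ).1 (hab hσ).2 (hmH _) (hmL _) (hmH _)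
      (hm _) (hLR _ _ hst) h
  have hmonopos : ∀ {σ : Fin m → ℝ}, IsStrategy σ → ∀ {s t : Fin m}, s ≤ t →
      0 < gain ρ c n pL pH σ (mL s) (mH s) → 0 < gain ρ c n pL pH σ (mL t) (mH t) :=
    fun hσ _ _ hst h => gain_pos_of_le (hab hσ).1 (hab hσ).2 (hmL _) (hmH _) (hmL _)
      (hm _) (hLR _ _ hst) h
  induction hd : m - k generalizing k with
  | zero =>
    have hz : ∀ s : Fin m, stepStrategy k 1 s = 0 := fun s => by
      have := s.2
      exact if_pos (by omega)
    refine ⟨stepStrategy k 1, isStrategy_stepStrategy k (by simp), fun s _ => hz s,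
      fun s => ⟨fun h => ?_, fun _ => hz s⟩⟩
    exact absurd (hk s (by have := s.2; omega)) (not_le.2 h)
  | succ d ih =>
    have hkm : k < m := by omega
    rcases lt_or_ge (gain ρ c n pL pH (stepStrategy k 0) (mL ⟨k, hkm⟩) (mH ⟨k, hkm⟩)) 0
      with h0 | h0
    · have hS := isStrategy_stepStrategy (m := m) k (w := 0) (by simp)
      have hlow : ∀ s : Fin m, s.val ≤ k →
          gain ρ c n pL pH (stepStrategy k 0) (mL s) (mH s) < 0 := by
        intro s hs
        by_contra! hge
        exact absurd (hmono hS (show s ≤ ⟨k, hkm⟩ from hs) hge) (not_le.2 h0)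
      by_cases hnext : ∃ h : k + 1 < m,
          0 < gain ρ c n pL pH (stepStrategy k 0) (mL ⟨k + 1, h⟩) (mH ⟨k + 1, h⟩)
      · obtain ⟨h1, hpos⟩ := hnext
        refine ⟨stepStrategy k 0, hS, fun s hs => if_pos hs, fun s => ?_⟩
        rcases le_or_gt s.val k with hsk | hsk
        · refine ⟨fun h => absurd (hlow s hsk) (not_lt.2 h.le), fun _ => ?_⟩
          unfold stepStrategy
          split_ifs <;> first | rfl | omega
        · refine ⟨fun _ => ?_, fun h => ?_⟩
          · unfold stepStrategy
            split_ifs <;> first | rfl | omega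
          · have := hmonopos hS (show (⟨k + 1, h1⟩ : Fin m) ≤ s from hsk) hpos
            linarith
      · rw [stepStrategy_succ] at hlow hnext
        obtain ⟨σ, hσ, hσ0, hσe⟩ := ih (k + 1) (fun s hs => by
          rcases Nat.lt_or_ge s.val (k + 1) with h | h
          · exact (hlow s (by omega)).le
          · have hs' : s.val = k + 1 := le_antisymm hs h
            have hlt : k + 1 < m := hs' ▸ s.2
            obtain rfl : s = ⟨k + 1, hlt⟩ := Fin.ext hs'
            exact not_lt.1 fun hp => hnext ⟨hlt, hp⟩) (by omega)
        exact ⟨σ, hσ, fun s hs => hσ0 s (by omega), hσe⟩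
    · obtain ⟨w, hw, hwz⟩ := intermediate_value_Icc' (zero_le_one' ℝ)
        (continuous_gain_stepStrategy ρ c n pL pH k (mL ⟨k, hkm⟩) (mH ⟨k, hkm⟩)).continuousOn
        ⟨hk ⟨k, hkm⟩ le_rfl, h0⟩
      have hS := isStrategy_stepStrategy (m := m) k hw
      refine ⟨stepStrategy k w, hS, fun s hs => if_pos hs, fun s => ?_⟩
      simp only at hwz
      rcases lt_trichotomy s.val k with h | h | h
      · refine ⟨fun hp => ?_, fun _ => if_pos h⟩
        have := hmonopos hS (show s ≤ ⟨k, hkm⟩ from h.le) hp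
        linarith
      · obtain rfl : s = ⟨k, hkm⟩ := Fin.ext h
        exact ⟨fun hp => absurd hwz hp.ne', fun hp => absurd hwz hp.ne⟩
      · refine ⟨fun _ => ?_, fun hp => ?_⟩
        · unfold stepStrategy
          split_ifs <;> first | rfl | omega
        · have := hmono hS (show (⟨k, hkm⟩ : Fin m) ≤ s from h.le) hwz.ge
          linarith

/-- The mass of `p` at `j` is split between the neighbours `i` and `k`. -/
structure SplitsAt {m : ℕ} (p q : Fin m → ℝ) (i j k : Fin m) : Prop where
  nonneg : ∀ s, 0 ≤ p s
  nonneg' : ∀ s, 0 ≤ q s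
  sum : ∑ s, p s = 1
  sum' : ∑ s, q s = 1
  left : p i = 0
  right : p k = 0
  mid : q j = 0
  split : q i + q k = p j
  agree : ∀ s, s ≠ i → s ≠ j → s ≠ k → q s = p s

lemma SplitsAt.rej_eq {m : ℕ} {p q : Fin m → ℝ} {i j k : Fin m} (h : SplitsAt p q i j k)
    (hij : i < j) (hjk : j < k) {σ τ : Fin m → ℝ} (hi : τ i = σ j) (hk : τ k = σ j)
    (ho : ∀ s, s ≠ i → s ≠ j → s ≠ k → τ s = σ s) : rej q τ = rej p σ := by
  have hpt : ∀ s, q s * τ s = p s * σ s + (if s = i then q i * σ j else 0) +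
      (if s = k then q k * σ j else 0) + (if s = j then -(p j * σ j) else 0) := by
    intro s
    by_cases h1 : s = i
    · subst h1
      simp [hij.ne, (hij.trans hjk).ne, hi, h.left]
    by_cases h2 : s = j
    · subst h2
      simp [h1, hjk.ne, h.mid]
    by_cases h3 : s = k
    · subst h3
      simp [h1, h2, hk, h.right]
    simp [h1, h2, h3, ho s h1 h2 h3, h.agree s h1 h2 h3]
  unfold rej
  rw [Finset.sum_congr rfl fun s _ => hpt s]
  simp only [Finset.sum_add_distrib, Finset.sum_ite_eq', Finset.mem_univ, if_true]
  rw [← h.split]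
  ring

/-- A local mean preserving spread of `(pL, pH)` at `j`, to the neighbours `i` and `k`. -/
structure IsSpread {m : ℕ} (pL pH qL qH : Fin m → ℝ) (i j k : Fin m) : Prop where
  low : SplitsAt pL qL i j k
  high : SplitsAt pH qH i j k
  supp : ∀ s, 0 < (pL s + qL s) + (pH s + qH s)
  ratio : ∀ s t, s ≤ t → (pH s + qH s) * (pL t + qL t) ≤ (pH t + qH t) * (pL s + qL s)
  hij : i < j
  hjk : j < k
  near : ∀ s, s ≠ i → s ≠ j → s ≠ k → s < i ∨ k < s

/-- The strategy of the spread experiment that replicates `σ`. -/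
def splitStrategy {m : ℕ} (i j k : Fin m) (σ : Fin m → ℝ) (s : Fin m) : ℝ :=
  if s = j then 0 else if s = i ∨ s = k then σ j else σ s

section Spread

variable {ρ c : ℝ} {n m : ℕ} {pL pH qL qH : Fin m → ℝ} {i j k : Fin m}

lemma isStrategy_splitStrategy {σ : Fin m → ℝ} (hσ : IsStrategy σ) :
    IsStrategy (splitStrategy i j k σ) := by
  intro s
  unfold splitStrategy
  split_ifs
  · simp
  · exact hσ j
  · exact hσ s

lemma SplitsAt.rej_splitStrategy {p q : Fin m → ℝ} (h : SplitsAt p q i j k) (hij : i < j)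
    (hjk : j < k) (σ : Fin m → ℝ) : rej q (splitStrategy i j k σ) = rej p σ := by
  refine h.rej_eq hij hjk ?_ ?_ fun s h1 h2 h3 => ?_
  · simp [splitStrategy, hij.ne]
  · simp [splitStrategy, hjk.ne']
  · simp [splitStrategy, h1, h2, h3]

lemma gain_congr {σ τ : Fin m → ℝ} (hL : rej qL τ = rej pL σ) (hH : rej qH τ = rej pH σ)
    (x y : ℝ) : gain ρ c n qL qH τ x y = gain ρ c n pL pH σ x y := by
  simp only [gain, visit, hL, hH]

lemma gain_add (σ : Fin m → ℝ) (x y x' y' : ℝ) : gain ρ c n pL pH σ (x + x') (y + y') =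
    gain ρ c n pL pH σ x y + gain ρ c n pL pH σ x' y' := by
  unfold gain
  ring

lemma gain_zero (σ : Fin m → ℝ) : gain ρ c n pL pH σ 0 0 = 0 := by
  simp [gain]

lemma IsSpread.surplus_le (hρ : ρ ∈ Set.Ioo (0 : ℝ) 1) (hc : c ∈ Set.Ioo (0 : ℝ) 1)
    (hn : 1 ≤ n) (h : IsSpread pL pH qL qH i j k) {σ τ : Fin m → ℝ}
    (hσ : IsEquilibrium ρ c n pL pH σ) (hτ : IsEquilibrium ρ c n qL qH τ)
    (hle : ∀ s, τ s ≤ splitStrategy i j k σ s) :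
    surplus ρ c n pL pH σ ≤ surplus ρ c n qL qH τ := by
  have eL := h.low.rej_splitStrategy h.hij h.hjk σ
  have eH := h.high.rej_splitStrategy h.hij h.hjk σ
  have hr : rej pH σ ≤ rej pL σ := by
    obtain ⟨hσs, hσe⟩ := (isEquilibrium_iff hρ hc hn h.low.nonneg h.high.nonneg h.low.sum
      h.high.sum).1 hσ
    exact rej_high_le_rej_low
      (mul_pos (mul_pos (by linarith [hc.2]) hρ.1) (visit_pos hn h.high.nonneg h.high.sum hσs))
      h.low.nonneg h.low.sum h.high.sum hσs fun s => ⟨(hσe s).1, (hσe s).2.1⟩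
  have := surplus_le_of_isEquilibrium hρ hc hn h.low.nonneg' h.high.nonneg' h.low.sum' h.high.sum'
    hτ (isStrategy_splitStrategy hσ.1) hle (by rw [eL, eH]; exact hr)
  unfold surplus at this ⊢
  rwa [eL, eH] at this

lemma rej_congr {p σ τ : Fin m → ℝ} (h : ∀ s, p s ≠ 0 → σ s = τ s) : rej p σ = rej p τ := by
  unfold rej
  congr 1
  refine Finset.sum_congr rfl fun s _ => ?_
  by_cases hs : p s = 0
  · simp [hs]
  · rw [h s hs]

lemma IsSpread.gain_off (h : IsSpread pL pH qL qH i j k) {rL rH : Fin m → ℝ} (σ : Fin m → ℝ)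
    {s : Fin m} (h1 : s ≠ i) (h2 : s ≠ j) (h3 : s ≠ k) :
    gain ρ c n rL rH σ (pL s + qL s) (pH s + qH s) =
      2 * gain ρ c n rL rH σ (pL s) (pH s) := by
  rw [gain_add, h.low.agree s h1 h2 h3, h.high.agree s h1 h2 h3, two_mul]

lemma IsSpread.isEquilibrium_base_iff (hρ : ρ ∈ Set.Ioo (0 : ℝ) 1) (hc : c ∈ Set.Ioo (0 : ℝ) 1)
    (hn : 1 ≤ n) (h : IsSpread pL pH qL qH i j k) {σ : Fin m → ℝ} :
    IsEquilibrium ρ c n pL pH σ ↔ IsStrategy σ ∧ σ i = 0 ∧ σ k = 0 ∧ ∀ s, s ≠ i → s ≠ k →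
      (0 < gain ρ c n pL pH σ (pL s + qL s) (pH s + qH s) → σ s = 1) ∧
      (gain ρ c n pL pH σ (pL s + qL s) (pH s + qH s) < 0 → σ s = 0) := by
  rw [isEquilibrium_iff hρ hc hn h.low.nonneg h.high.nonneg h.low.sum h.high.sum]
  refine and_congr_right fun _ => ⟨fun hσ => ?_, fun ⟨hi, hk, hσ⟩ s => ?_⟩
  · refine ⟨(hσ i).2.2 h.low.left h.high.left, (hσ k).2.2 h.low.right h.high.right,
      fun s h1 h3 => ?_⟩
    by_cases h2 : s = j
    · subst h2
      simpa [h.low.mid, h.high.mid] using ⟨(hσ s).1, (hσ s).2.1⟩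
    · rw [h.gain_off σ h1 h2 h3]
      exact ⟨fun hp => (hσ s).1 (by linarith), fun hp => (hσ s).2.1 (by linarith)⟩
  · by_cases h1 : s = i
    · subst h1
      simp [h.low.left, h.high.left, gain_zero, hi]
    by_cases h3 : s = k
    · subst h3
      simp [h.low.right, h.high.right, gain_zero, hk]
    have hs := hσ s h1 h3
    have hm := h.supp s
    by_cases h2 : s = j
    · subst h2
      simp only [h.low.mid, h.high.mid, add_zero] at hs hm
      exact ⟨hs.1, hs.2, fun e1 e2 => by simp [e1, e2] at hm⟩
    · rw [h.gain_off σ h1 h2 h3] at hs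
      rw [h.low.agree s h1 h2 h3, h.high.agree s h1 h2 h3] at hm
      exact ⟨fun hp => hs.1 (by linarith), fun hp => hs.2 (by linarith),
        fun e1 e2 => by simp [e1, e2] at hm⟩

lemma IsSpread.isEquilibrium_spread_iff (hρ : ρ ∈ Set.Ioo (0 : ℝ) 1) (hc : c ∈ Set.Ioo (0 : ℝ) 1)
    (hn : 1 ≤ n) (h : IsSpread pL pH qL qH i j k) {τ : Fin m → ℝ} :
    IsEquilibrium ρ c n qL qH τ ↔ IsStrategy τ ∧ τ j = 0 ∧ ∀ s, s ≠ j →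
      (0 < gain ρ c n qL qH τ (pL s + qL s) (pH s + qH s) → τ s = 1) ∧
      (gain ρ c n qL qH τ (pL s + qL s) (pH s + qH s) < 0 → τ s = 0) := by
  rw [isEquilibrium_iff hρ hc hn h.low.nonneg' h.high.nonneg' h.low.sum' h.high.sum']
  have hjoint : ∀ s, s ≠ j → ∃ t : ℝ, 0 < t ∧
      gain ρ c n qL qH τ (pL s + qL s) (pH s + qH s) = t * gain ρ c n qL qH τ (qL s) (qH s) := by
    intro s h2
    by_cases h1 : s = i
    · exact ⟨1, one_pos, by rw [h1, h.low.left, h.high.left]; simp⟩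
    by_cases h3 : s = k
    · exact ⟨1, one_pos, by rw [h3, h.low.right, h.high.right]; simp⟩
    exact ⟨2, two_pos, by
      rw [h.gain_off τ h1 h2 h3, h.low.agree s h1 h2 h3, h.high.agree s h1 h2 h3]⟩
  have hmass : ∀ s, s ≠ j → qL s = 0 → qH s = 0 → False := by
    intro s h2 e1 e2
    have hm := h.supp s
    by_cases h1 : s = i
    · subst h1
      simp [h.low.left, h.high.left, e1, e2] at hm
    by_cases h3 : s = k
    · subst h3
      simp [h.low.right, h.high.right, e1, e2] at hm
    rw [← h.low.agree s h1 h2 h3, ← h.high.agree s h1 h2 h3, e1, e2] at hm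
    simp at hm
  refine and_congr_right fun _ => ⟨fun hτ => ?_, fun ⟨hj, hτ⟩ s => ?_⟩
  · refine ⟨(hτ j).2.2 h.low.mid h.high.mid, fun s h2 => ?_⟩
    obtain ⟨t, ht, e⟩ := hjoint s h2
    rw [e, mul_pos_iff_of_pos_left ht, ← smul_eq_mul, smul_neg_iff_of_pos_left ht]
    exact ⟨(hτ s).1, (hτ s).2.1⟩
  · by_cases h2 : s = j
    · subst h2
      simp [h.low.mid, h.high.mid, gain_zero, hj]
    · obtain ⟨t, ht, e⟩ := hjoint s h2
      have hs := hτ s h2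
      rw [e, mul_pos_iff_of_pos_left ht, ← smul_eq_mul, smul_neg_iff_of_pos_left ht] at hs
      exact ⟨hs.1, hs.2, fun e1 e2 => (hmass s h2 e1 e2).elim⟩

lemma gain_coeff_pos (hρ : ρ ∈ Set.Ioo (0 : ℝ) 1) (hc : c ∈ Set.Ioo (0 : ℝ) 1) (hn : 1 ≤ n)
    (hL : ∀ s, 0 ≤ pL s) (hH : ∀ s, 0 ≤ pH s) (hLs : ∑ s, pL s = 1) (hHs : ∑ s, pH s = 1)
    {σ : Fin m → ℝ} (hσ : IsStrategy σ) :
    0 < (1 - c) * ρ * visit n pH σ ∧ 0 < c * (1 - ρ) * visit n pL σ :=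
  ⟨mul_pos (mul_pos (by linarith [hc.2]) hρ.1) (visit_pos hn hH hHs hσ),
    mul_pos (mul_pos hc.1 (by linarith [hρ.2])) (visit_pos hn hL hLs hσ)⟩

lemma IsSpread.gain_mono (h : IsSpread pL pH qL qH i j k) {rL rH σ : Fin m → ℝ}
    (hab : 0 < (1 - c) * ρ * visit n rH σ ∧ 0 < c * (1 - ρ) * visit n rL σ) {s t : Fin m}
    (hst : s ≤ t) :
    (0 ≤ gain ρ c n rL rH σ (pL s + qL s) (pH s + qH s) →
      0 ≤ gain ρ c n rL rH σ (pL t + qL t) (pH t + qH t)) ∧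
    (0 < gain ρ c n rL rH σ (pL s + qL s) (pH s + qH s) →
      0 < gain ρ c n rL rH σ (pL t + qL t) (pH t + qH t)) := by
  have hL := fun s => add_nonneg (h.low.nonneg s) (h.low.nonneg' s)
  have hH := fun s => add_nonneg (h.high.nonneg s) (h.high.nonneg' s)
  exact ⟨gain_nonneg_of_le hab.1 hab.2 (hH s) (hL t) (hH t) (h.supp s) (h.ratio s t hst),
    gain_pos_of_le hab.1 hab.2 (hL s) (hH s) (hL t) (h.supp t) (h.ratio s t hst)⟩

lemma IsSpread.le_splitStrategy_of_mostSelective (hρ : ρ ∈ Set.Ioo (0 : ℝ) 1)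
    (hc : c ∈ Set.Ioo (0 : ℝ) 1) (hn : 1 ≤ n) (h : IsSpread pL pH qL qH i j k)
    {σ τ : Fin m → ℝ} (hσ : IsEquilibrium ρ c n pL pH σ) (hσj : σ j = 1)
    (hτ : MostSelective ρ c n qL qH τ) (s : Fin m) : τ s ≤ splitStrategy i j k σ s := by
  obtain ⟨hσs, hσi, hσk, hσe⟩ := (h.isEquilibrium_base_iff hρ hc hn).1 hσ
  have hab := gain_coeff_pos hρ hc hn h.low.nonneg h.high.nonneg h.low.sum h.high.sum hσs
  have eL := h.low.rej_splitStrategy h.hij h.hjk σ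
  have eH := h.high.rej_splitStrategy h.hij h.hjk σ
  have hji := h.hij.ne'
  have hjk := h.hjk.ne
  have hGj : 0 ≤ gain ρ c n pL pH σ (pL j + qL j) (pH j + qH j) := by
    by_contra! hlt
    rw [(hσe j hji hjk).2 hlt] at hσj
    exact zero_ne_one hσj
  rcases le_or_gt 0 (gain ρ c n pL pH σ (pL i + qL i) (pH i + qH i)) with hGi | hGi
  · refine hτ.2 _ ((h.isEquilibrium_spread_iff hρ hc hn).2
      ⟨isStrategy_splitStrategy hσs, by simp [splitStrategy], fun s h2 => ?_⟩) s
    rw [gain_congr eL eH]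
    by_cases h13 : s = i ∨ s = k
    · have his : i ≤ s := by
        rcases h13 with rfl | rfl
        · exact le_rfl
        · exact (h.hij.trans h.hjk).le
      refine ⟨fun _ => by simp [splitStrategy, h2, h13, hσj], fun hneg => ?_⟩
      exact absurd ((h.gain_mono hab his).1 hGi) (not_le.2 hneg)
    · have := hσe s (fun e => h13 (.inl e)) (fun e => h13 (.inr e))
      simpa [splitStrategy, h2, h13] using this
  · have hGk : 0 < gain ρ c n pL pH σ (pL k + qL k) (pH k + qH k) := by
      have e : gain ρ c n pL pH σ (pL i + qL i) (pH i + qH i) +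
          gain ρ c n pL pH σ (pL k + qL k) (pH k + qH k) =
          gain ρ c n pL pH σ (pL j + qL j) (pH j + qH j) := by
        rw [← gain_add, h.low.left, h.low.right, h.low.mid, h.high.left, h.high.right, h.high.mid,
          ← h.low.split, ← h.high.split]
        simp
      linarith
    have hlow : ∀ s, s ≤ i → gain ρ c n pL pH σ (pL s + qL s) (pH s + qH s) < 0 := by
      intro s hs
      by_contra! hge
      exact absurd ((h.gain_mono hab hs).1 hge) (not_le.2 hGi)
    have hstep : ∀ s, s ≠ j → splitStrategy i j k σ s = stepStrategy i.val 1 s := by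
      intro s h2
      have hik := h.hij.trans h.hjk
      by_cases h13 : s = i ∨ s = k
      · have his : ¬ s.val < i.val := by
          rcases h13 with rfl | rfl
          · exact lt_irrefl _
          · exact not_lt.2 hik.le
        simp [splitStrategy, stepStrategy, h2, h13, hσj, his]
      · have hs1 : s ≠ i := fun e => h13 (.inl e)
        have hs3 : s ≠ k := fun e => h13 (.inr e)
        rcases h.near s hs1 h2 hs3 with hs | hs
        · have hs' : s.val < i.val := hs
          simp [splitStrategy, stepStrategy, h2, h13, hs', (hσe s hs1 hs3).2 (hlow s hs.le)]
        · have hs' : ¬ s.val < i.val := not_lt.2 (hik.trans hs).le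
          simp [splitStrategy, stepStrategy, h2, h13, hs',
            (hσe s hs1 hs3).1 ((h.gain_mono hab hs.le).2 hGk)]
    have hrej : ∀ {q : Fin m → ℝ}, q j = 0 →
        rej q (stepStrategy i.val 1) = rej q (splitStrategy i j k σ) := fun hq =>
      rej_congr fun s hs => (hstep s fun e => hs (e ▸ hq)).symm
    obtain ⟨ω, hω, hω0, hωe⟩ := exists_optimal_below hρ hc hn h.low.nonneg' h.high.nonneg'
      h.low.sum' h.high.sum' (fun s => add_nonneg (h.low.nonneg s) (h.low.nonneg' s))
      (fun s => add_nonneg (h.high.nonneg s) (h.high.nonneg' s)) h.supp h.ratio i.val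
      (fun s hs => by
        rw [gain_congr ((hrej h.low.mid).trans eL) ((hrej h.high.mid).trans eH)]
        exact (hlow s hs).le)
    have hupd : ∀ {q : Fin m → ℝ}, q j = 0 → rej q (Function.update ω j 0) = rej q ω := fun hq =>
      rej_congr fun s hs => Function.update_of_ne (fun e => hs (by rw [e, hq])) _ _
    have hle := hτ.2 (Function.update ω j 0) ((h.isEquilibrium_spread_iff hρ hc hn).2
      ⟨fun s => by
        by_cases h2 : s = j
        · subst h2; simp
        · simpa [h2] using hω s, by simp, fun s h2 => by
          rw [gain_congr (hupd h.low.mid) (hupd h.high.mid), Function.update_of_ne h2]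
          exact hωe s⟩) s
    refine hle.trans ?_
    by_cases h2 : s = j
    · subst h2
      simp [splitStrategy]
    · rw [Function.update_of_ne h2, hstep s h2]
      by_cases hs : s.val < i.val
      · rw [hω0 s hs, stepStrategy, if_pos hs]
      · refine (hω s).2.trans_eq ?_
        simp [stepStrategy, hs]

lemma LeastSelective.eq_one_of_gain_eq_zero (hρ : ρ ∈ Set.Ioo (0 : ℝ) 1)
    (hc : c ∈ Set.Ioo (0 : ℝ) 1) (hn : 1 ≤ n)
    (hL : ∀ s, 0 ≤ pL s) (hH : ∀ s, 0 ≤ pH s) (hLs : ∑ s, pL s = 1) (hHs : ∑ s, pH s = 1)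
    {σ : Fin m → ℝ} (hσ : LeastSelective ρ c n pL pH σ) {s t : Fin m} (hst : s ≠ t)
    (hms : 0 < pL s + pH s) (hmt : 0 < pL t + pH t)
    (hgs : gain ρ c n pL pH σ (pL s) (pH s) = 0) (hgt : gain ρ c n pL pH σ (pL t) (pH t) = 0)
    (hs : 0 < σ s) : σ t = 1 := by
  by_contra hne
  obtain ⟨τ, hτ, hlt⟩ := exists_isEquilibrium_lt hρ hc hn hL hH hLs hHs hσ.1 hst hms hmt hgs hgt
    hs (lt_of_le_of_ne (hσ.1.1 t).2 hne)
  exact absurd (hσ.2 τ hτ t) (not_le.2 hlt)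

lemma IsSpread.eq_one_of_leastSelective (hρ : ρ ∈ Set.Ioo (0 : ℝ) 1)
    (hc : c ∈ Set.Ioo (0 : ℝ) 1) (hn : 1 ≤ n) (h : IsSpread pL pH qL qH i j k)
    {σ : Fin m → ℝ} (hσ : LeastSelective ρ c n pL pH σ) (hσj : σ j = 1) {s : Fin m}
    (hs : k < s) : σ s = 1 := by
  obtain ⟨hσs, -, -, hσe⟩ := (h.isEquilibrium_base_iff hρ hc hn).1 hσ.1
  have hab := gain_coeff_pos hρ hc hn h.low.nonneg h.high.nonneg h.low.sum h.high.sum hσs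
  have hjs := h.hjk.trans hs
  have hsi := (h.hij.trans hjs).ne'
  by_contra hne
  have hGs : gain ρ c n pL pH σ (pL s + qL s) (pH s + qH s) ≤ 0 :=
    not_lt.1 fun hp => hne ((hσe s hsi hs.ne').1 hp)
  have hGj : 0 ≤ gain ρ c n pL pH σ (pL j + qL j) (pH j + qH j) :=
    not_lt.1 fun hp => by
      rw [(hσe j h.hij.ne' h.hjk.ne).2 hp] at hσj
      exact zero_ne_one hσj
  have hGs0 := hGs.antisymm ((h.gain_mono hab hjs.le).1 hGj)
  have hGj0 := hGj.antisymm' (not_lt.1 fun hp => hGs.not_gt ((h.gain_mono hab hjs.le).2 hp))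
  have hms := h.supp s
  have hmj := h.supp j
  rw [h.gain_off σ hsi hjs.ne' hs.ne'] at hGs0
  rw [h.low.agree s hsi hjs.ne' hs.ne', h.high.agree s hsi hjs.ne' hs.ne'] at hms
  simp only [h.low.mid, h.high.mid, add_zero] at hGj0 hmj
  exact hne (hσ.eq_one_of_gain_eq_zero hρ hc hn h.low.nonneg h.high.nonneg h.low.sum h.high.sum
    hjs.ne hmj (by linarith) hGj0 (by linarith) (by rw [hσj]; exact one_pos))

lemma IsSpread.eq_zero_of_leastSelective (hρ : ρ ∈ Set.Ioo (0 : ℝ) 1)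
    (hc : c ∈ Set.Ioo (0 : ℝ) 1) (hn : 1 ≤ n) (h : IsSpread pL pH qL qH i j k)
    {τ : Fin m → ℝ} (hτ : LeastSelective ρ c n qL qH τ) (hne : ¬ (τ i = 1 ∧ τ k = 1)) {s : Fin m}
    (hs : s < i) : τ s = 0 := by
  obtain ⟨hτs, -, hτe⟩ := (h.isEquilibrium_spread_iff hρ hc hn).1 hτ.1
  have hab := gain_coeff_pos hρ hc hn h.low.nonneg' h.high.nonneg' h.low.sum' h.high.sum' hτs
  have hij := h.hij
  have hjk := h.hjk
  have hik := hij.trans hjk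
  have hmi := h.supp i
  have hmk := h.supp k
  simp only [h.low.left, h.high.left, zero_add] at hmi
  simp only [h.low.right, h.high.right, zero_add] at hmk
  -- an indifferent pair with acceptance at the worse signal forces acceptance at the better one
  have htie : ∀ {s t : Fin m}, s < t → s ≠ j → t ≠ j → 0 < τ s → τ t ≠ 1 →
      gain ρ c n qL qH τ (pL s + qL s) (pH s + qH s) = 0 ∧
      gain ρ c n qL qH τ (pL t + qL t) (pH t + qH t) = 0 := by
    intro s t hst h2 h2' hs0 ht1
    have hGs : 0 ≤ gain ρ c n qL qH τ (pL s + qL s) (pH s + qH s) :=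
      not_lt.1 fun hp => hs0.ne' ((hτe s h2).2 hp)
    have hGt : gain ρ c n qL qH τ (pL t + qL t) (pH t + qH t) ≤ 0 :=
      not_lt.1 fun hp => ht1 ((hτe t h2').1 hp)
    exact ⟨hGs.antisymm' (not_lt.1 fun hp => hGt.not_gt ((h.gain_mono hab hst.le).2 hp)),
      hGt.antisymm ((h.gain_mono hab hst.le).1 hGs)⟩
  by_contra hs0
  have hs0' := lt_of_le_of_ne (hτs s).1 (Ne.symm hs0)
  have hsj := (hs.trans hij).ne
  have hsk := (hs.trans hik).ne
  by_cases hi1 : τ i = 1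
  · have hk1 : τ k ≠ 1 := fun e => hne ⟨hi1, e⟩
    obtain ⟨e1, e2⟩ := htie hik hij.ne hjk.ne' (by rw [hi1]; exact one_pos) hk1
    simp only [h.low.left, h.high.left, zero_add] at e1
    simp only [h.low.right, h.high.right, zero_add] at e2
    exact hk1 (hτ.eq_one_of_gain_eq_zero hρ hc hn h.low.nonneg' h.high.nonneg' h.low.sum'
      h.high.sum' hik.ne hmi hmk e1 e2 (by rw [hi1]; exact one_pos))
  · obtain ⟨e1, e2⟩ := htie hs hsj hij.ne hs0' hi1
    have hms := h.supp s
    simp only [h.low.left, h.high.left, zero_add] at e2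
    rw [h.gain_off τ hs.ne hsj hsk] at e1
    rw [← h.low.agree s hs.ne hsj hsk, ← h.high.agree s hs.ne hsj hsk] at hms e1
    exact hi1 (hτ.eq_one_of_gain_eq_zero hρ hc hn h.low.nonneg' h.high.nonneg' h.low.sum'
      h.high.sum' hs.ne (by linarith) hmi (by linarith) e2 hs0')

lemma IsSpread.le_splitStrategy_of_leastSelective (hρ : ρ ∈ Set.Ioo (0 : ℝ) 1)
    (hc : c ∈ Set.Ioo (0 : ℝ) 1) (hn : 1 ≤ n) (h : IsSpread pL pH qL qH i j k)
    {σ τ : Fin m → ℝ} (hσ : LeastSelective ρ c n pL pH σ) (hσj : σ j = 1)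
    (hτ : LeastSelective ρ c n qL qH τ) (s : Fin m) : τ s ≤ splitStrategy i j k σ s := by
  obtain ⟨hτs, hτj, hτe⟩ := (h.isEquilibrium_spread_iff hρ hc hn).1 hτ.1
  have hij := h.hij
  have hjk := h.hjk
  suffices hoff : ∀ s, s ≠ i → s ≠ j → s ≠ k → τ s ≤ σ s by
    unfold splitStrategy
    split_ifs with h2 h13
    · rw [h2, hτj]
    · rw [hσj]; exact (hτs s).2
    · exact hoff s (fun e => h13 (.inl e)) h2 (fun e => h13 (.inr e))
  intro s h1 h2 h3
  by_cases hik1 : τ i = 1 ∧ τ k = 1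
  · obtain ⟨hi1, hk1⟩ := hik1
    set μ : Fin m → ℝ := fun s => if s = i ∨ s = k then 0 else if s = j then 1 else τ s with hμ
    have hμj : μ j = 1 := by simp [hμ, hij.ne', hjk.ne]
    have hμo : ∀ s, s ≠ i → s ≠ j → s ≠ k → τ s = μ s := fun s h1 h2 h3 => by
      simp [hμ, h1, h2, h3]
    have eL := h.low.rej_eq hij hjk (hi1.trans hμj.symm) (hk1.trans hμj.symm) hμo
    have eH := h.high.rej_eq hij hjk (hi1.trans hμj.symm) (hk1.trans hμj.symm) hμo
    have hab := gain_coeff_pos hρ hc hn h.low.nonneg' h.high.nonneg' h.low.sum' h.high.sum' hτs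
    have hμE : IsEquilibrium ρ c n pL pH μ := by
      refine (h.isEquilibrium_base_iff hρ hc hn).2 ⟨fun s => ?_, by simp [hμ], by simp [hμ],
        fun s h1 h3 => ?_⟩
      · simp only [hμ]
        split_ifs
        · simp
        · simp
        · exact hτs s
      · rw [← gain_congr eL eH]
        by_cases h2 : s = j
        · subst h2
          refine ⟨fun _ => hμj, fun hneg => ?_⟩
          have hGi : 0 ≤ gain ρ c n qL qH τ (pL i + qL i) (pH i + qH i) :=
            not_lt.1 fun hp => by
              rw [(hτe i hij.ne).2 hp] at hi1
              exact zero_ne_one hi1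
          exact absurd ((h.gain_mono hab hij.le).1 hGi) (not_le.2 hneg)
        · rw [← hμo s h1 h2 h3]
          exact hτe s h2
    rw [hμo s h1 h2 h3]
    exact hσ.2 μ hμE s
  · rcases h.near s h1 h2 h3 with hs | hs
    · rw [h.eq_zero_of_leastSelective hρ hc hn hτ hik1 hs]
      exact (hσ.1.1 s).1
    · rw [h.eq_one_of_leastSelective hρ hc hn hσ hσj hs]
      exact (hτs s).2

end Spread

/-- negative overrides raise surplus. The experiments `E = (pL, pH)` and
`E' = (qL, qH)` live on the joint outcome set `Fin M` (enumerated in nondecreasing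
likelihood-ratio order of the combined family), and `E'` differs from `E` by a local
mean preserving spread at index `j`. If the most (resp. least) selective equilibrium
strategy of `E` accepts at `j` for sure, then extremal-equilibrium surplus under `E'`
weakly exceeds that under `E`. -/
theorem negative_override_raises_surplus
    (ρ c : ℝ) (hρ : ρ ∈ Set.Ioo (0:ℝ) 1) (hc : c ∈ Set.Ioo (0:ℝ) 1)
    (n : ℕ) (hn : 1 ≤ n) (M : ℕ)
    (pL pH qL qH : Fin M → ℝ)
    (hpL0 : ∀ s, 0 ≤ pL s) (hpH0 : ∀ s, 0 ≤ pH s)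
    (hqL0 : ∀ s, 0 ≤ qL s) (hqH0 : ∀ s, 0 ≤ qH s)
    (hpLsum : ∑ s, pL s = 1) (hpHsum : ∑ s, pH s = 1)
    (hqLsum : ∑ s, qL s = 1) (hqHsum : ∑ s, qH s = 1)
    (hsupp : ∀ s, 0 < pL s + pH s + qL s + qH s)
    (hLR : ∀ i k : Fin M, i ≤ k →
      (pH i + qH i) * (pL k + qL k) ≤ (pH k + qH k) * (pL i + qL i))
    (j : ℕ) (hj1 : 1 ≤ j) (hj2 : j + 1 < M)
    (hqjL : qL ⟨j, by omega⟩ = 0) (hqjH : qH ⟨j, by omega⟩ = 0)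
    (hpjmL : pL ⟨j - 1, by omega⟩ = 0) (hpjmH : pH ⟨j - 1, by omega⟩ = 0)
    (hpjpL : pL ⟨j + 1, by omega⟩ = 0) (hpjpH : pH ⟨j + 1, by omega⟩ = 0)
    (hsplitL : qL ⟨j - 1, by omega⟩ + qL ⟨j + 1, by omega⟩ = pL ⟨j, by omega⟩)
    (hsplitH : qH ⟨j - 1, by omega⟩ + qH ⟨j + 1, by omega⟩ = pH ⟨j, by omega⟩)
    (hagree : ∀ s : Fin M, s.val ≠ j - 1 → s.val ≠ j → s.val ≠ j + 1 →
      qL s = pL s ∧ qH s = pH s) :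
    (∀ σE σE' : Fin M → ℝ, MostSelective ρ c n pL pH σE →
      MostSelective ρ c n qL qH σE' → σE ⟨j, by omega⟩ = 1 →
      surplus ρ c n pL pH σE ≤ surplus ρ c n qL qH σE') ∧
    (∀ σE σE' : Fin M → ℝ, LeastSelective ρ c n pL pH σE →
      LeastSelective ρ c n qL qH σE' → σE ⟨j, by omega⟩ = 1 →
      surplus ρ c n pL pH σE ≤ surplus ρ c n qL qH σE') := by
  have hspread : IsSpread pL pH qL qH (⟨j - 1, by omega⟩ : Fin M) ⟨j, by omega⟩
      ⟨j + 1, by omega⟩ :=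
    { low := ⟨hpL0, hqL0, hpLsum, hqLsum, hpjmL, hpjpL, hqjL, hsplitL, fun s h1 h2 h3 =>
        (hagree s (fun e => h1 (Fin.ext e)) (fun e => h2 (Fin.ext e))
          (fun e => h3 (Fin.ext e))).1⟩
      high := ⟨hpH0, hqH0, hpHsum, hqHsum, hpjmH, hpjpH, hqjH, hsplitH, fun s h1 h2 h3 =>
        (hagree s (fun e => h1 (Fin.ext e)) (fun e => h2 (Fin.ext e))
          (fun e => h3 (Fin.ext e))).2⟩
      supp := fun s => by linarith [hsupp s]
      ratio := hLR
      hij := Fin.mk_lt_mk.2 (by omega)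
      hjk := Fin.mk_lt_mk.2 (by omega)
      near := fun s h1 h2 h3 => by
        simp only [Fin.lt_def, ne_eq, Fin.ext_iff] at h1 h2 h3 ⊢
        omega }
  exact ⟨fun σE σE' hσ hτ hj => hspread.surplus_le hρ hc hn hσ.1 hτ.1
      (hspread.le_splitStrategy_of_mostSelective hρ hc hn hσ.1 hj hτ),
    fun σE σE' hσ hτ hj => hspread.surplus_le hρ hc hn hσ.1 hτ.1
      (hspread.le_splitStrategy_of_leastSelective hρ hc hn hσ hj hτ)⟩
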